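/- Let p be a prime, n ≥ 1, and ψ : ℕ → ℝ₊ with Σ_{k=1}^∞ k^{n} ψ(k) < ∞. Then the set of y ∈ ℤ_p^n such that there exist infinitely many (a₀,a) ∈ ℤ × (ℤ^n \ {0}) with |a₀ + a·y|_p ≤ ψ(max(|a₀|, ‖a‖)) has Haar measure zero. -/

import Mathlib

open MeasureTheory
open scoped BigOperators

noncomputable instance (p : ℕ) [Fact p.Prime] : MeasurableSpace ℤ_[p] := borel _
instance (p : ℕ) [Fact p.Prime] : BorelSpace ℤ_[p] := ⟨rfl⟩

namespace PadicKhintchine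

open Filter Topology

variable {p n : ℕ}

/-! ### Measures of balls and of neighbourhoods of hyperplanes -/

section Measure

variable [Fact p.Prime]

lemma measure_norm_le_pow (ν : Measure ℤ_[p]) [ν.IsAddHaarMeasure] (hν : ν Set.univ = 1) (m : ℕ) :
    ν {z | ‖z‖ ≤ (p : ℝ) ^ (-(m : ℤ))} ≤ ENNReal.ofReal ((p : ℝ) ^ (-(m : ℤ))) := by
  set B : Set ℤ_[p] := {z | ‖z‖ ≤ (p : ℝ) ^ (-(m : ℤ))} with hB
  have hBm : MeasurableSet B := (isClosed_le continuous_norm continuous_const).measurableSet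
  have hp : 0 < (p : ℝ) := by exact_mod_cast (Fact.out : p.Prime).pos
  have hdisj : Set.PairwiseDisjoint (↑(Finset.range (p ^ m)))
      (fun j : ℕ => (fun z : ℤ_[p] => -(j : ℤ_[p]) + z) ⁻¹' B) := by
    intro i hi j hj hij
    refine Set.disjoint_left.2 fun z hzi hzj => hij ?_
    simp only [hB, Set.mem_preimage, Set.mem_ofPred_eq] at hzi hzj
    have hsub : ‖(((i : ℤ) - (j : ℤ) : ℤ) : ℤ_[p])‖ ≤ (p : ℝ) ^ (-(m : ℤ)) := by
      have h := PadicInt.nonarchimedean (-(j : ℤ_[p]) + z) (-(-(i : ℤ_[p]) + z))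
      rw [norm_neg] at h
      refine le_trans (le_of_eq ?_) (h.trans (max_le hzj hzi))
      push_cast
      congr 1
      ring
    rw [PadicInt.norm_int_le_pow_iff_dvd, ← Nat.cast_pow] at hsub
    simp only [Finset.coe_range, Set.mem_Iio] at hi hj
    have := Int.eq_zero_of_abs_lt_dvd hsub (by rw [abs_lt]; constructor <;> omega)
    omega
  have hsum := sum_measure_le_measure_univ (μ := ν) (s := Finset.range (p ^ m))
    (t := fun j : ℕ => (fun z : ℤ_[p] => -(j : ℤ_[p]) + z) ⁻¹' B)
    (fun j _ => (hBm.preimage (measurable_const_add _)).nullMeasurableSet)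
    fun i hi j hj hij => (hdisj hi hj hij).aedisjoint
  simp only [measure_preimage_add, Finset.sum_const, Finset.card_range, hν, nsmul_eq_mul] at hsum
  have hpm : (0 : ℝ) < (p : ℝ) ^ m := by positivity
  rw [zpow_neg, zpow_natCast, ENNReal.ofReal_inv_of_pos hpm, ENNReal.ofReal_pow hp.le,
    ENNReal.ofReal_natCast, ENNReal.le_inv_iff_mul_le, mul_comm]
  exact_mod_cast hsum

lemma measure_norm_le (ν : Measure ℤ_[p]) [ν.IsAddHaarMeasure] (hν : ν Set.univ = 1)
    {ε : ℝ} (hε : 0 < ε) : ν {z | ‖z‖ ≤ ε} ≤ ENNReal.ofReal (p * ε) := by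
  have hp : 1 < (p : ℝ) := by exact_mod_cast (Fact.out : p.Prime).one_lt
  rcases le_or_gt ε 1 with h1 | h1
  · obtain ⟨m, hm, hm'⟩ := exists_nat_pow_near_of_lt_one hε h1
      (inv_pos.2 (zero_lt_one.trans hp)) (inv_lt_one_of_one_lt₀ hp)
    rw [inv_pow] at hm hm'
    refine (measure_mono fun z (hz : ‖z‖ ≤ ε) => ?_).trans
      ((measure_norm_le_pow ν hν m).trans (ENNReal.ofReal_le_ofReal ?_))
    · simpa using hz.trans hm'
    · rw [zpow_neg, zpow_natCast]
      calc ((p : ℝ) ^ m)⁻¹ = p * ((p : ℝ) ^ (m + 1))⁻¹ := by field_simp; ring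
        _ ≤ p * ε := by gcongr
  · refine (measure_mono (Set.subset_univ _)).trans ?_
    rw [hν, ENNReal.one_le_ofReal]
    nlinarith

lemma measure_singleton_zero (ν : Measure ℤ_[p]) [ν.IsAddHaarMeasure] (hν : ν Set.univ = 1) :
    ν {0} = 0 := by
  have hp : 1 < (p : ℝ) := by exact_mod_cast (Fact.out : p.Prime).one_lt
  have hlim : Tendsto (fun m : ℕ => ENNReal.ofReal (((p : ℝ)⁻¹) ^ m)) atTop (𝓝 0) := by
    simpa using ENNReal.tendsto_ofReal (tendsto_pow_atTop_nhds_zero_of_lt_one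
      (inv_nonneg.2 (zero_le_one.trans hp.le)) (inv_lt_one_of_one_lt₀ hp))
  refine le_antisymm (ge_of_tendsto' hlim fun m => ?_) zero_le
  refine (measure_mono ?_).trans ((measure_norm_le_pow ν hν m).trans_eq (by simp))
  rintro _ rfl
  simp

lemma measurePreserving_sum_mul (ν : Measure ℤ_[p]) [ν.IsAddHaarMeasure] (hν : ν Set.univ = 1)
    (b : Fin n → ℤ_[p]) (hb : ∃ i, IsUnit (b i)) :
    MeasurePreserving (fun y : Fin n → ℤ_[p] => ∑ i, b i * y i) (Measure.pi fun _ => ν) ν := by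
  have : IsProbabilityMeasure ν := ⟨hν⟩
  let f : (Fin n → ℤ_[p]) →+ ℤ_[p] :=
    { toFun := fun y => ∑ i, b i * y i
      map_zero' := by simp
      map_add' := fun x y => by simp [mul_add, Finset.sum_add_distrib] }
  have hf : Continuous f := by
    change Continuous fun y : Fin n → ℤ_[p] => ∑ i, b i * y i
    fun_prop
  have hsurj : Function.Surjective f := by
    obtain ⟨i, u, hu⟩ := hb
    intro z
    refine ⟨Pi.single i (↑u⁻¹ * z), ?_⟩
    change ∑ j, b j * (Pi.single i (↑u⁻¹ * z) : Fin n → ℤ_[p]) j = z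
    rw [Finset.sum_eq_single i (fun j _ hj => by simp [hj]) (by simp)]
    simp [← hu]
  have := Measure.isAddHaarMeasure_map_of_isFiniteMeasure (Measure.pi fun _ : Fin n => ν) f hf hsurj
  have : IsProbabilityMeasure (Measure.map f (Measure.pi fun _ : Fin n => ν)) :=
    Measure.isProbabilityMeasure_map hf.measurable.aemeasurable
  exact ⟨hf.measurable, Measure.isAddHaarMeasure_eq_of_isProbabilityMeasure _ _⟩

lemma measure_norm_add_sum_le (ν : Measure ℤ_[p]) [ν.IsAddHaarMeasure] (hν : ν Set.univ = 1)
    (c : ℤ_[p]) (b : Fin n → ℤ_[p]) (hb : ∃ i, IsUnit (b i)) {ε : ℝ} (hε : 0 < ε) :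
    (Measure.pi fun _ : Fin n => ν) {y | ‖c + ∑ i, b i * y i‖ ≤ ε} ≤ ENNReal.ofReal (p * ε) := by
  have hB : MeasurableSet {z : ℤ_[p] | ‖z‖ ≤ ε} :=
    (isClosed_le continuous_norm continuous_const).measurableSet
  have h := (measurePreserving_sum_mul ν hν b hb).measure_preimage
    (hB.preimage (measurable_const_add c)).nullMeasurableSet
  rw [measure_preimage_add] at h
  exact (le_of_eq h).trans (measure_norm_le ν hν hε)

end Measure

/-! ### Counting integer vectors of given height -/

/-- The height `max(|a₀|, ‖a‖)` of an integer vector `(a₀, a)`. -/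
def height (a : ℤ × (Fin n → ℤ)) : ℕ :=
  max a.1.natAbs (Finset.univ.sup fun i => (a.2 i).natAbs)

lemma height_le_iff {a : ℤ × (Fin n → ℤ)} {u : ℕ} :
    height a ≤ u ↔ a.1.natAbs ≤ u ∧ ∀ i, (a.2 i).natAbs ≤ u := by
  simp [height]

lemma natAbs_le_height (a : ℤ × (Fin n → ℤ)) (i : Fin n) : (a.2 i).natAbs ≤ height a :=
  (height_le_iff.1 le_rfl).2 i

lemma height_mul (c : ℤ) (a : ℤ × (Fin n → ℤ)) :
    height (c * a.1, fun i => c * a.2 i) = c.natAbs * height a := by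
  have hmono : Monotone fun k : ℕ => c.natAbs * k := fun _ _ h => Nat.mul_le_mul_left _ h
  have hsup := Finset.apply_sup_eq_sup_comp_of_linearOrder (s := Finset.univ)
    (f := fun i => (a.2 i).natAbs) _ hmono (mul_zero _)
  simp only [height, Int.natAbs_mul]
  exact ((hmono.map_max).trans (congrArg _ hsup)).symm

/-- The integer vectors of height at most `u`. -/
noncomputable def box (n u : ℕ) : Finset (ℤ × (Fin n → ℤ)) :=
  Finset.Icc (-(u : ℤ)) u ×ˢ Fintype.piFinset fun _ => Finset.Icc (-(u : ℤ)) u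

lemma mem_box {u : ℕ} {a : ℤ × (Fin n → ℤ)} : a ∈ box n u ↔ height a ≤ u := by
  simp only [box, Finset.mem_product, Fintype.mem_piFinset, Finset.mem_Icc, height_le_iff]
  refine and_congr (by omega) (forall_congr' fun i => by omega)

lemma card_box (n u : ℕ) : (box n u).card = (2 * u + 1) ^ (n + 1) := by
  have : ((u : ℤ) + 1 + u).toNat = 2 * u + 1 := by omega
  simp [box, this, pow_succ']

/-- The integer vectors of height `u` having some nonconstant coordinate prime to `p`. -/
noncomputable def shell (p n u : ℕ) : Finset (ℤ × (Fin n → ℤ)) :=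
  (box n u).filter fun a => height a = u ∧ ∃ i, ¬ (p : ℤ) ∣ a.2 i

lemma mem_shell {u : ℕ} {a : ℤ × (Fin n → ℤ)} :
    a ∈ shell p n u ↔ height a = u ∧ ∃ i, ¬ (p : ℤ) ∣ a.2 i := by
  simp only [shell, Finset.mem_filter, mem_box, and_iff_right_iff_imp]
  exact fun h => h.1.le

lemma height_pos_of_not_dvd {a : ℤ × (Fin n → ℤ)} (h : ∃ i, ¬ (p : ℤ) ∣ a.2 i) :
    0 < height a := by
  obtain ⟨i, hi⟩ := h
  refine lt_of_lt_of_le (Int.natAbs_pos.2 fun h0 => hi ?_) (natAbs_le_height a i)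
  simp [h0]

lemma card_shell_le (u : ℕ) :
    ((shell p n u).card : ℝ) ≤ 2 * (n + 1) * 3 ^ n * (u : ℝ) ^ n := by
  rcases Nat.eq_zero_or_pos u with rfl | hu
  · have : shell p n 0 = ∅ := by
      ext a
      simp only [mem_shell, Finset.notMem_empty, iff_false, not_and]
      exact fun h h' => (height_pos_of_not_dvd h').ne' h
    rw [this, Finset.card_empty, Nat.cast_zero]
    positivity
  · have hsub : shell p n u ⊆ box n u \ box n (u - 1) := by
      intro a ha
      rw [mem_shell] at ha
      rw [Finset.mem_sdiff, mem_box, mem_box]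
      omega
    have hbox : box n (u - 1) ⊆ box n u := by
      intro a
      simp only [mem_box]
      omega
    have hcard := Finset.card_le_card hsub
    have hle := Finset.card_le_card hbox
    rw [Finset.card_sdiff_of_subset hbox, card_box, card_box] at hcard
    rw [card_box, card_box] at hle
    have hu1 : (1 : ℝ) ≤ u := by exact_mod_cast hu
    have habs := abs_pow_sub_pow_le (2 * (u : ℝ) + 1) (2 * (u - 1) + 1) (n + 1)
    rw [abs_of_nonneg (by linarith : (0 : ℝ) ≤ 2 * (u : ℝ) + 1),
      abs_of_nonneg (by linarith : (0 : ℝ) ≤ 2 * ((u : ℝ) - 1) + 1),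
      max_eq_left (by linarith), Nat.add_sub_cancel] at habs
    calc ((shell p n u).card : ℝ)
        ≤ (((2 * u + 1) ^ (n + 1) - (2 * (u - 1) + 1) ^ (n + 1) : ℕ) : ℝ) := by exact_mod_cast hcard
      _ = (2 * (u : ℝ) + 1) ^ (n + 1) - (2 * (u - 1) + 1) ^ (n + 1) := by
        rw [Nat.cast_sub hle]
        push_cast [Nat.cast_sub hu]
        rfl
      _ ≤ 2 * (n + 1) * (2 * u + 1) ^ n := by
        refine (le_abs_self _).trans (habs.trans_eq ?_)
        rw [show 2 * (u : ℝ) + 1 - (2 * (u - 1) + 1) = 2 by ring]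
        simp
      _ ≤ 2 * (n + 1) * (3 * u) ^ n := by gcongr; linarith
      _ = 2 * (n + 1) * 3 ^ n * (u : ℝ) ^ n := by rw [mul_pow]; ring

/-! ### The Borel–Cantelli argument -/

variable [Fact p.Prime]

/-- The value `a₀ + a · y`. -/
noncomputable def form (a : ℤ × (Fin n → ℤ)) (y : Fin n → ℤ_[p]) : ℤ_[p] :=
  (a.1 : ℤ_[p]) + ∑ i, (a.2 i : ℤ_[p]) * y i

/-- The points `y` which are solutions for `p ^ v • b`, for some `b` in the shell of height `u`;
here `w = (u, v)`. -/
def solutions (p n : ℕ) [Fact p.Prime] (ψ : ℕ → ℝ) (w : ℕ × ℕ) : Set (Fin n → ℤ_[p]) :=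
  {y | ∃ b ∈ shell p n w.1, ‖form b y‖ ≤ p ^ w.2 * ψ (p ^ w.2 * w.1)}

lemma measure_solutions_le (ν : Measure ℤ_[p]) [ν.IsAddHaarMeasure] (hν : ν Set.univ = 1)
    {ψ : ℕ → ℝ} (hψ : ∀ k, 0 < ψ k) (w : ℕ × ℕ) :
    (Measure.pi fun _ : Fin n => ν) (solutions p n ψ w) ≤
      ENNReal.ofReal (2 * (n + 1) * 3 ^ n * p *
        ((w.1 : ℝ) ^ n * (p ^ w.2 * ψ (p ^ w.2 * w.1)))) := by
  have hp : 0 < (p : ℝ) := by exact_mod_cast (Fact.out : p.Prime).pos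
  set ε : ℝ := p ^ w.2 * ψ (p ^ w.2 * w.1) with hε
  have hε0 : 0 < ε := mul_pos (by positivity) (hψ _)
  have hunion : solutions p n ψ w = ⋃ b ∈ shell p n w.1, {y | ‖form b y‖ ≤ ε} := by
    ext y
    simp [solutions, hε]
  rw [hunion]
  refine (measure_biUnion_finset_le _ _).trans ?_
  refine (Finset.sum_le_card_nsmul _ _ (ENNReal.ofReal (p * ε)) fun b hb => ?_).trans ?_
  · refine measure_norm_add_sum_le ν hν _ _ ?_ hε0
    obtain ⟨i, hi⟩ := (mem_shell.1 hb).2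
    refine ⟨i, PadicInt.isUnit_iff.2 (le_antisymm (PadicInt.norm_le_one _) ?_)⟩
    rwa [← not_lt, PadicInt.norm_int_lt_one_iff_dvd]
  · rw [nsmul_eq_mul, ← ENNReal.ofReal_natCast, ← ENNReal.ofReal_mul (by positivity)]
    refine ENNReal.ofReal_le_ofReal ?_
    calc ((shell p n w.1).card : ℝ) * (p * ε)
        ≤ (2 * (n + 1) * 3 ^ n * (w.1 : ℝ) ^ n) * (p * ε) := by gcongr; exact card_shell_le _
      _ = _ := by ring

lemma ae_finite_solutions (ν : Measure ℤ_[p]) [ν.IsAddHaarMeasure] (hν : ν Set.univ = 1)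
    {ψ : ℕ → ℝ} (hψ : ∀ k, 0 < ψ k) (T : Set (ℕ × ℕ))
    (hT : Summable fun w : T => (w.1.1 : ℝ) ^ n * (p ^ w.1.2 * ψ (p ^ w.1.2 * w.1.1))) :
    ∀ᵐ y ∂(Measure.pi fun _ : Fin n => ν), {w | w ∈ T ∧ y ∈ solutions p n ψ w}.Finite := by
  have hlt : ∑' w : T, (Measure.pi fun _ : Fin n => ν) (solutions p n ψ w) ≠ ⊤ :=
    ne_top_of_le_ne_top (hT.mul_left (2 * (n + 1) * 3 ^ n * p : ℝ)).tsum_ofReal_ne_top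
      (ENNReal.tsum_le_tsum fun w => measure_solutions_le ν hν hψ w)
  filter_upwards [ae_finite_setOfPred_mem hlt] with y hy
  refine (hy.image Subtype.val).subset ?_
  rintro w ⟨hw, hwy⟩
  exact ⟨⟨w, hw⟩, hwy, rfl⟩

/-! ### Reduction to vectors prime to `p` -/

lemma exists_pow_mul_not_dvd {a : Fin n → ℤ} (ha : a ≠ 0) :
    ∃ (v : ℕ) (b : Fin n → ℤ), (∀ i, a i = (p : ℤ) ^ v * b i) ∧ ∃ i, ¬ (p : ℤ) ∣ b i := by
  classical
  have hp1 : 1 < p := (Fact.out : p.Prime).one_lt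
  have hex : ∃ N : ℕ, ∃ i, ¬ (p : ℤ) ^ N ∣ a i := by
    obtain ⟨i, hi⟩ := Function.ne_iff.1 ha
    refine ⟨(a i).natAbs, i, fun h => ?_⟩
    have := Nat.le_of_dvd (Int.natAbs_pos.2 hi) (Int.natAbs_dvd_natAbs.2 h)
    rw [Int.natAbs_pow, Int.natAbs_natCast] at this
    exact absurd this (not_le.2 (Nat.lt_pow_self hp1))
  obtain ⟨v, hv⟩ : ∃ v, Nat.find hex = v + 1 := by
    refine Nat.exists_eq_succ_of_ne_zero fun h0 => ?_
    obtain ⟨i, hi⟩ := Nat.find_spec hex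
    rw [h0] at hi
    simp at hi
  have hdvd : ∀ i, (p : ℤ) ^ v ∣ a i := by
    have := Nat.find_min hex (m := v) (by omega)
    push Not at this
    exact this
  choose b hb using hdvd
  obtain ⟨i, hi⟩ := Nat.find_spec hex
  refine ⟨v, b, hb, i, fun h => hi ?_⟩
  rw [hv, hb i, pow_succ]
  exact mul_dvd_mul_left _ h

lemma one_le_natAbs_mul_norm {a : ℤ} (ha : a ≠ 0) : 1 ≤ (a.natAbs : ℝ) * ‖(a : ℤ_[p])‖ := by
  have ha' : (a : ℤ_[p]) ≠ 0 := by exact_mod_cast ha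
  have hp : 0 < (p : ℝ) := by exact_mod_cast (Fact.out : p.Prime).pos
  have hnorm := PadicInt.norm_eq_zpow_neg_valuation ha'
  have hdvd := PadicInt.norm_int_le_pow_iff_dvd.1 hnorm.le
  have hle := Nat.le_of_dvd (Int.natAbs_pos.2 ha) (Int.natAbs_dvd_natAbs.2 hdvd)
  rw [Int.natAbs_pow, Int.natAbs_natCast] at hle
  have hle' : (p : ℝ) ^ (a : ℤ_[p]).valuation ≤ a.natAbs := by exact_mod_cast hle
  rw [hnorm, zpow_neg, zpow_natCast, ← div_eq_mul_inv, one_le_div (by positivity)]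
  exact hle'

lemma exists_shell_of_small {a : ℤ × (Fin n → ℤ)} (ha : a.2 ≠ 0) {y : Fin n → ℤ_[p]}
    {ε : ℝ} (hy : ‖form a y‖ ≤ ε) (hε : height a * ε < 1) :
    ∃ (v : ℕ) (b : ℤ × (Fin n → ℤ)), a = ((p : ℤ) ^ v * b.1, fun i => (p : ℤ) ^ v * b.2 i) ∧
      height a = p ^ v * height b ∧ (∃ i, ¬ (p : ℤ) ∣ b.2 i) ∧ ‖form b y‖ ≤ p ^ v * ε := by
  have hp : 0 < (p : ℝ) := by exact_mod_cast (Fact.out : p.Prime).pos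
  obtain ⟨v, b, hb, hbi⟩ := exists_pow_mul_not_dvd (p := p) ha
  have hdvd : (p : ℤ) ^ v ∣ a.1 := by
    by_contra hnd
    have ha0 : a.1 ≠ 0 := fun h => hnd (h ▸ dvd_zero _)
    have hbig : (p : ℝ) ^ (-(v : ℤ)) < ‖(a.1 : ℤ_[p])‖ := by
      rw [← not_le, PadicInt.norm_int_le_pow_iff_dvd]
      exact hnd
    have hsmall : ‖∑ i, (a.2 i : ℤ_[p]) * y i‖ ≤ (p : ℝ) ^ (-(v : ℤ)) := by
      rw [PadicInt.norm_le_pow_iff_mem_span_pow, Ideal.mem_span_singleton]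
      refine Finset.dvd_sum fun i _ => Dvd.dvd.mul_right ?_ _
      rw [PadicInt.pow_p_dvd_int_iff, hb i]
      exact dvd_mul_right _ _
    have heq : ‖form a y‖ = ‖(a.1 : ℤ_[p])‖ := by
      rw [form, PadicInt.norm_add_eq_max_of_ne (hsmall.trans_lt hbig).ne',
        max_eq_left (hsmall.trans hbig.le)]
    have h1 := one_le_natAbs_mul_norm (p := p) ha0
    have h2 : (a.1.natAbs : ℝ) ≤ height a := by exact_mod_cast (height_le_iff.1 le_rfl).1
    have h3 : (a.1.natAbs : ℝ) * ‖(a.1 : ℤ_[p])‖ ≤ height a * ε := by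
      rw [← heq]
      gcongr
    linarith
  obtain ⟨b₀, hb₀⟩ := hdvd
  have haeq : a = ((p : ℤ) ^ v * b₀, fun i => (p : ℤ) ^ v * b i) :=
    Prod.ext hb₀ (funext hb)
  refine ⟨v, (b₀, b), haeq, ?_, hbi, ?_⟩
  · conv_lhs => rw [haeq]
    rw [height_mul ((p : ℤ) ^ v) (b₀, b), Int.natAbs_pow, Int.natAbs_natCast]
  · have hform : form a y = (p : ℤ_[p]) ^ v * form (b₀, b) y := by
      rw [haeq]
      simp only [form, Int.cast_mul, Int.cast_pow, Int.cast_natCast, mul_add, Finset.mul_sum,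
        mul_assoc]
    rw [hform, norm_mul, PadicInt.norm_p_pow, zpow_neg, zpow_natCast] at hy
    rwa [inv_mul_le_iff₀ (by positivity)] at hy

lemma finite_of_finite_solutions {ψ : ℕ → ℝ} (hψ : ∀ᶠ k : ℕ in atTop, k * ψ k < 1)
    {y : Fin n → ℤ_[p]} (T : Set (ℕ × ℕ))
    (hfin : {w | w ∈ T ∧ y ∈ solutions p n ψ w}.Finite)
    (hT : ∀ (b : ℤ × (Fin n → ℤ)) (v : ℕ), (∃ i, ¬ (p : ℤ) ∣ b.2 i) →
      height b * ‖form b y‖ < 1 → (height b, v) ∈ T) :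
    {a : ℤ × (Fin n → ℤ) | a.2 ≠ 0 ∧ ‖form a y‖ ≤ ψ (height a)}.Finite := by
  obtain ⟨K, hK⟩ := eventually_atTop.1 hψ
  refine ((box n K).finite_toSet.union (hfin.biUnion fun w _ =>
    ((shell p n w.1).finite_toSet.image fun b =>
      ((p : ℤ) ^ w.2 * b.1, fun i => (p : ℤ) ^ w.2 * b.2 i)))).subset ?_
  rintro a ⟨ha, hay⟩
  rcases le_total (height a) K with hle | hge
  · exact Or.inl (mem_box.2 hle)
  · right
    have hlt := hK _ hge
    obtain ⟨v, b, hab, hh, hbi, hby⟩ := exists_shell_of_small ha hay hlt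
    have hmem : b ∈ shell p n (height b) := mem_shell.2 ⟨rfl, hbi⟩
    refine Set.mem_biUnion (x := (height b, v)) ⟨hT b v hbi ?_, b, hmem, ?_⟩ ⟨b, hmem, hab.symm⟩
    · refine lt_of_le_of_lt ?_ hlt
      calc (height b : ℝ) * ‖form b y‖ ≤ height b * (p ^ v * ψ (height a)) := by gcongr
        _ = height a * ψ (height a) := by rw [hh]; push_cast; ring
    · rwa [← hh]

/-! ### Summability over pairs `(u, v)` -/

lemma summable_of_two_le {ψ : ℕ → ℝ} (hψ : ∀ k, 0 < ψ k) (hn : 2 ≤ n)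
    (hsum : Summable fun k : ℕ => (k : ℝ) ^ n * ψ k) :
    Summable fun w : ℕ × ℕ => (w.1 : ℝ) ^ n * (p ^ w.2 * ψ (p ^ w.2 * w.1)) := by
  have hp : 1 < (p : ℝ) := by exact_mod_cast (Fact.out : p.Prime).one_lt
  have hprod := hsum.mul_of_nonneg
    (summable_geometric_of_lt_one (inv_nonneg.2 (zero_le_one.trans hp.le))
      (inv_lt_one_of_one_lt₀ hp))
    (fun k => mul_nonneg (by positivity) (hψ k).le)
    (fun v => pow_nonneg (inv_nonneg.2 (zero_le_one.trans hp.le)) v)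
  have hinj : Function.Injective fun w : ℕ × ℕ => (p ^ w.2 * w.1, w.2) := by
    rintro ⟨u, v⟩ ⟨u', v'⟩ h
    obtain ⟨h1, rfl⟩ := Prod.mk.inj h
    simpa [(Fact.out : p.Prime).ne_zero] using h1
  refine (hprod.comp_injective hinj).of_nonneg_of_le
    (fun w => mul_nonneg (by positivity) (mul_nonneg (by positivity) (hψ _).le)) fun w => ?_
  obtain ⟨u, v⟩ := w
  simp only [Function.comp_apply, inv_pow, Nat.cast_mul, Nat.cast_pow]
  have hpv : 1 ≤ (p : ℝ) ^ v := one_le_pow₀ hp.le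
  have hpow : ((p : ℝ) ^ v) ^ 2 ≤ ((p : ℝ) ^ v) ^ n := pow_le_pow_right₀ hpv hn
  have hψ' := (hψ (p ^ v * u)).le
  calc (u : ℝ) ^ n * (p ^ v * ψ (p ^ v * u))
      = ((p : ℝ) ^ v) ^ 2 * (u : ℝ) ^ n * ψ (p ^ v * u) * ((p : ℝ) ^ v)⁻¹ := by
        field_simp
    _ ≤ ((p : ℝ) ^ v) ^ n * (u : ℝ) ^ n * ψ (p ^ v * u) * ((p : ℝ) ^ v)⁻¹ := by gcongr
    _ = _ := by rw [mul_pow]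

lemma summable_of_not_dvd {ψ : ℕ → ℝ} (hψ : ∀ k, 0 < ψ k) (r : ℕ)
    (hsum : Summable fun k : ℕ => (k : ℝ) ^ 1 * ψ k) :
    Summable fun w : {w : ℕ × ℕ | ¬ p ^ r ∣ w.1} =>
      (w.1.1 : ℝ) ^ 1 * (p ^ w.1.2 * ψ (p ^ w.1.2 * w.1.1)) := by
  have hp : p.Prime := Fact.out
  have hprod := hsum.mul_of_nonneg (Summable.of_finite (f := fun _ : Fin r => (1 : ℝ)))
    (fun k => mul_nonneg (by positivity) (hψ k).le) (fun _ => zero_le_one)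
  have hne : ∀ w : {w : ℕ × ℕ | ¬ p ^ r ∣ w.1}, w.1.1 ≠ 0 := fun w h => w.2 (h ▸ dvd_zero _)
  have hval : ∀ w : {w : ℕ × ℕ | ¬ p ^ r ∣ w.1}, padicValNat p w.1.1 < r := fun w => by
    rw [← not_le, ← padicValNat_dvd_iff_le (hne w)]
    exact w.2
  have hinj : Function.Injective fun w : {w : ℕ × ℕ | ¬ p ^ r ∣ w.1} =>
      (p ^ w.1.2 * w.1.1, (⟨padicValNat p w.1.1, hval w⟩ : Fin r)) := by
    intro w w' h
    obtain ⟨h1, h2⟩ := Prod.mk.inj h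
    have h3 := congrArg (padicValNat p) h1
    rw [padicValNat.mul (pow_ne_zero _ hp.ne_zero) (hne w),
      padicValNat.mul (pow_ne_zero _ hp.ne_zero) (hne w'), padicValNat.prime_pow,
      padicValNat.prime_pow, Fin.mk.inj h2, Nat.add_right_cancel_iff] at h3
    rw [h3] at h1
    exact Subtype.ext (Prod.ext (Nat.eq_of_mul_eq_mul_left (pow_pos hp.pos _) h1) h3)
  refine (hprod.comp_injective hinj).congr fun w => ?_
  simp only [Function.comp_apply]
  push_cast
  ring

/-! ### The one-dimensional case -/

lemma not_dvd_height_of_lt_norm {b : ℤ × (Fin 1 → ℤ)} {y : Fin 1 → ℤ_[p]} {r : ℕ} (hr : 0 < r)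
    (hb : ∃ i, ¬ (p : ℤ) ∣ b.2 i) (hy : (p : ℝ) ^ (-(r : ℤ)) < ‖y 0‖)
    (hlt : height b * ‖form b y‖ < 1) : ¬ p ^ r ∣ height b := by
  intro hdvd
  have hp : 0 < (p : ℝ) := by exact_mod_cast (Fact.out : p.Prime).pos
  have hpos := height_pos_of_not_dvd hb
  obtain ⟨i, hi⟩ := hb
  obtain rfl := Subsingleton.elim i 0
  have hheight : height b = max b.1.natAbs (b.2 0).natAbs := by simp [height]
  have hb₀ : height b = b.1.natAbs := by
    refine (max_choice b.1.natAbs (b.2 0).natAbs).elim (hheight.trans ·) fun h => ?_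
    refine absurd (Int.natCast_dvd.2 ?_) hi
    rw [← h, ← hheight]
    exact (dvd_pow_self p hr.ne').trans hdvd
  have hnorm₀ : ‖(b.1 : ℤ_[p])‖ ≤ (p : ℝ) ^ (-(r : ℤ)) := by
    rw [PadicInt.norm_int_le_pow_iff_dvd, ← Nat.cast_pow, Int.natCast_dvd, ← hb₀]
    exact hdvd
  have hle : (p : ℝ) ^ r ≤ height b := by exact_mod_cast Nat.le_of_dvd hpos hdvd
  have hform : ‖form b y‖ ≤ (p : ℝ) ^ (-(r : ℤ)) := by
    rw [zpow_neg, zpow_natCast, ← one_div, le_div_iff₀' (by positivity)]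
    exact (mul_le_mul_of_nonneg_right hle (norm_nonneg _)).trans hlt.le
  have hunit : ‖(b.2 0 : ℤ_[p])‖ = 1 := by
    refine le_antisymm (PadicInt.norm_le_one _) ?_
    rwa [← not_lt, PadicInt.norm_int_lt_one_iff_dvd]
  have hyeq : ‖y 0‖ = ‖form b y + -(b.1 : ℤ_[p])‖ := by
    rw [form, Fin.sum_univ_one, add_neg_cancel_comm, norm_mul, hunit, one_mul]
  refine hy.not_ge ?_
  rw [hyeq]
  exact (PadicInt.nonarchimedean _ _).trans (max_le hform ((norm_neg _).trans_le hnorm₀))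

lemma ae_finite_of_eq_one (ν : Measure ℤ_[p]) [ν.IsAddHaarMeasure] (hν : ν Set.univ = 1)
    {ψ : ℕ → ℝ} (hψ : ∀ k, 0 < ψ k) (hsum : Summable fun k : ℕ => (k : ℝ) ^ 1 * ψ k)
    (hψ' : ∀ᶠ k : ℕ in atTop, k * ψ k < 1) :
    ∀ᵐ y ∂(Measure.pi fun _ : Fin 1 => ν),
      {a : ℤ × (Fin 1 → ℤ) | a.2 ≠ 0 ∧ ‖form a y‖ ≤ ψ (height a)}.Finite := by
  have : IsProbabilityMeasure ν := ⟨hν⟩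
  have hfin := ae_all_iff.2 fun r : ℕ =>
    ae_finite_solutions ν hν hψ {w | ¬ p ^ r ∣ w.1} (summable_of_not_dvd hψ r hsum)
  have hne : ∀ᵐ y ∂(Measure.pi fun _ : Fin 1 => ν), y 0 ≠ 0 := by
    refine (measurePreserving_eval (fun _ : Fin 1 => ν) 0).quasiMeasurePreserving.ae
      (p := fun z => z ≠ 0) ?_
    simpa [ae_iff] using measure_singleton_zero ν hν
  filter_upwards [hfin, hne] with y hy hy0
  obtain ⟨r, hr⟩ := PadicInt.exists_pow_neg_lt p (norm_pos_iff.2 hy0)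
  have hp : 1 < (p : ℝ) := by exact_mod_cast (Fact.out : p.Prime).one_lt
  have hr' : (p : ℝ) ^ (-((r + 1 : ℕ) : ℤ)) < ‖y 0‖ :=
    (zpow_le_zpow_right₀ hp.le (by omega)).trans_lt hr
  exact finite_of_finite_solutions hψ' _ (hy (r + 1)) fun b v hb hlt =>
    not_dvd_height_of_lt_norm r.succ_pos hb hr' hlt

lemma eventually_mul_lt_one {ψ : ℕ → ℝ} (hψ : ∀ k, 0 < ψ k) (hn : 1 ≤ n)
    (hsum : Summable fun k : ℕ => (k : ℝ) ^ n * ψ k) : ∀ᶠ k : ℕ in atTop, k * ψ k < 1 := by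
  filter_upwards [hsum.tendsto_atTop_zero.eventually_lt_const zero_lt_one,
    eventually_ge_atTop 1] with k hk hk1
  refine lt_of_le_of_lt (mul_le_mul_of_nonneg_right ?_ (hψ k).le) hk
  exact le_self_pow₀ (by exact_mod_cast hk1) (by omega)

end PadicKhintchine

/-- (Convergence case of the `p`-adic Khintchine theorem, dual setting.)
If `Σ kⁿ ψ(k) < ∞`, then w.r.t. the normalized Haar (product) measure on `ℤ_pⁿ`,
almost no `y` admits infinitely many `(a₀, a) ∈ ℤ × (ℤⁿ \ {0})` with
`|a₀ + a·y|_p ≤ ψ(max(|a₀|, ‖a‖))`. -/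
theorem padic_khintchine_convergence (p : ℕ) [Fact p.Prime] (n : ℕ) (hn : 1 ≤ n)
    (ψ : ℕ → ℝ) (hψ : ∀ k, 0 < ψ k)
    (hsum : Summable fun k : ℕ => (k : ℝ) ^ n * ψ k)
    (ν : Measure ℤ_[p]) [ν.IsAddHaarMeasure] (hν : ν Set.univ = 1) :
    (Measure.pi fun _ : Fin n => ν)
      {y : Fin n → ℤ_[p] |
        {aa : ℤ × (Fin n → ℤ) | aa.2 ≠ 0 ∧
          ‖((aa.1 : ℤ) : ℤ_[p]) + ∑ i, ((aa.2 i : ℤ) : ℤ_[p]) * y i‖ ≤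
            ψ (max aa.1.natAbs (Finset.univ.sup fun i => (aa.2 i).natAbs))}.Infinite}
      = 0 := by
  have hψ' := PadicKhintchine.eventually_mul_lt_one hψ hn hsum
  suffices h : ∀ᵐ y ∂(Measure.pi fun _ : Fin n => ν),
      {a : ℤ × (Fin n → ℤ) | a.2 ≠ 0 ∧
        ‖PadicKhintchine.form a y‖ ≤ ψ (PadicKhintchine.height a)}.Finite from ae_iff.1 h
  rcases hn.eq_or_lt with rfl | hn
  · exact PadicKhintchine.ae_finite_of_eq_one ν hν hψ hsum hψ'
  · filter_upwards [PadicKhintchine.ae_finite_solutions ν hν hψ Set.univ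
      ((PadicKhintchine.summable_of_two_le hψ hn hsum).subtype _)] with y hy
    exact PadicKhintchine.finite_of_finite_solutions hψ' _ hy fun _ _ _ _ => Set.mem_univ _
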